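/- Let Ω ⊆ ℝⁿ be open, n ≥ 2, and let u : Ω → ℝ be a smooth function with |Du(x)| < 1 for all x ∈ Ω. Then the following are equivalent: (i) div(Du/√(1+|Du|²)) = 0 and div(Du/√(1−|Du|²)) = 0 on Ω (the graph of u is simultaneously minimal and maximal); (ii) Δu = 0 and D²u(Du, Du) = 0 at every point of Ω. -/

import Mathlib

open scoped RealInnerProductSpace

/-- Divergence of a vector field on ℝⁿ. -/
noncomputable def vdiv {n : ℕ} (X : EuclideanSpace ℝ (Fin n) → EuclideanSpace ℝ (Fin n))
    (x : EuclideanSpace ℝ (Fin n)) : ℝ :=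
  ∑ i, ⟪fderiv ℝ X x (EuclideanSpace.single i 1), EuclideanSpace.single i 1⟫

/-- Hessian bilinear form `D²u(x)(v,w)` of a function on ℝⁿ. -/
noncomputable def hess {n : ℕ} (u : EuclideanSpace ℝ (Fin n) → ℝ)
    (x v w : EuclideanSpace ℝ (Fin n)) : ℝ :=
  ⟪fderiv ℝ (gradient u) x v, w⟫

/-- The Lorentz–Minkowski inner product on ℝⁿ × ℝ = 𝕃^{n+1}. -/
noncomputable def linner {n : ℕ} (p q : EuclideanSpace ℝ (Fin n) × ℝ) : ℝ :=
  ⟪p.1, q.1⟫ - p.2 * q.2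
/-- The product rule for the divergence: `div (f X) = f div X + Df(X)`. -/
lemma vdiv_smul {n : ℕ} {f : EuclideanSpace ℝ (Fin n) → ℝ}
    {X : EuclideanSpace ℝ (Fin n) → EuclideanSpace ℝ (Fin n)} {x : EuclideanSpace ℝ (Fin n)}
    (hf : DifferentiableAt ℝ f x) (hX : DifferentiableAt ℝ X x) :
    vdiv (fun y => f y • X y) x = f x * vdiv X x + fderiv ℝ f x (X x) := by
  have h : fderiv ℝ f x (X x) = ∑ i, fderiv ℝ f x (EuclideanSpace.single i 1) * X x i := by
    conv_lhs => rw [← (EuclideanSpace.basisFun (Fin n) ℝ).sum_repr (X x)]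
    simp [mul_comm]
  rw [h]
  unfold vdiv
  rw [fderiv_fun_smul hf hX, Finset.mul_sum, ← Finset.sum_add_distrib]
  refine Finset.sum_congr rfl fun i _ => ?_
  simp [inner_add_left, inner_smul_left, EuclideanSpace.inner_single_right]

/-- The divergence of `X / √(1 + c|X|²)`. -/
lemma vdiv_inv_sqrt_smul {n : ℕ} {X : EuclideanSpace ℝ (Fin n) → EuclideanSpace ℝ (Fin n)}
    {x : EuclideanSpace ℝ (Fin n)} (hX : DifferentiableAt ℝ X x) (c : ℝ)
    (hc : 0 < 1 + c * ‖X x‖ ^ 2) :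
    vdiv (fun y => (Real.sqrt (1 + c * ‖X y‖ ^ 2))⁻¹ • X y) x =
      (Real.sqrt (1 + c * ‖X x‖ ^ 2) ^ 3)⁻¹ *
        ((1 + c * ‖X x‖ ^ 2) * vdiv X x - c * ⟪fderiv ℝ X x (X x), X x⟫) := by
  have hs : 0 < Real.sqrt (1 + c * ‖X x‖ ^ 2) := Real.sqrt_pos.2 hc
  have hq := ((hX.hasFDerivAt.norm_sq.const_mul c).const_add 1).sqrt hc.ne'
  have hf := (hasDerivAt_inv hs.ne').comp_hasFDerivAt x hq
  have h := vdiv_smul (f := fun y => (Real.sqrt (1 + c * ‖X y‖ ^ 2))⁻¹)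
    hf.differentiableAt hX
  rw [h, show fderiv ℝ (fun y => (Real.sqrt (1 + c * ‖X y‖ ^ 2))⁻¹) x = _ from hf.fderiv]
  have hsq := Real.sq_sqrt hc.le
  simp only [smul_apply, ContinuousLinearMap.comp_apply, smul_eq_mul,
    innerSL_apply_apply, real_inner_comm (X x)]
  set s := Real.sqrt (1 + c * ‖X x‖ ^ 2)
  rw [← hsq]
  field_simp
  simp
  ring

lemma differentiableAt_gradient {n : ℕ} {Ω : Set (EuclideanSpace ℝ (Fin n))} (hΩ : IsOpen Ω)
    {u : EuclideanSpace ℝ (Fin n) → ℝ} (hu : ContDiffOn ℝ 2 u Ω)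
    {x : EuclideanSpace ℝ (Fin n)} (hx : x ∈ Ω) : DifferentiableAt ℝ (gradient u) x := by
  have h : DifferentiableAt ℝ (fderiv ℝ u) x :=
    ((hu.contDiffAt (hΩ.mem_nhds hx)).fderiv_right (m := 1) (by norm_num)).differentiableAt
      (by norm_num)
  exact (InnerProductSpace.toDual ℝ
    (EuclideanSpace ℝ (Fin n))).symm.toContinuousLinearEquiv.differentiableAt.comp x h

/-- A spacelike graph is simultaneously minimal and maximal iff its defining
function is harmonic and its Hessian annihilates the gradient direction. -/
theorem minimal_and_maximal_iff {n : ℕ} (hn : 2 ≤ n)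
    (Ω : Set (EuclideanSpace ℝ (Fin n))) (hΩ : IsOpen Ω)
    (u : EuclideanSpace ℝ (Fin n) → ℝ) (hu : ContDiffOn ℝ (⊤ : ℕ∞) u Ω)
    (hsp : ∀ x ∈ Ω, ‖gradient u x‖ < 1) :
    ((∀ x ∈ Ω,
        vdiv (fun y => (Real.sqrt (1 + ‖gradient u y‖ ^ 2))⁻¹ • gradient u y) x = 0) ∧
      (∀ x ∈ Ω,
        vdiv (fun y => (Real.sqrt (1 - ‖gradient u y‖ ^ 2))⁻¹ • gradient u y) x = 0)) ↔
    (∀ x ∈ Ω, vdiv (gradient u) x = 0 ∧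
      hess u x (gradient u x) (gradient u x) = 0) := by
  have key : ∀ x ∈ Ω,
      (vdiv (fun y => (Real.sqrt (1 + ‖gradient u y‖ ^ 2))⁻¹ • gradient u y) x = 0 ↔
        (1 + ‖gradient u x‖ ^ 2) * vdiv (gradient u) x -
          hess u x (gradient u x) (gradient u x) = 0) ∧
      (vdiv (fun y => (Real.sqrt (1 - ‖gradient u y‖ ^ 2))⁻¹ • gradient u y) x = 0 ↔
        (1 - ‖gradient u x‖ ^ 2) * vdiv (gradient u) x +
          hess u x (gradient u x) (gradient u x) = 0) := by
    intro x hx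
    have hd := differentiableAt_gradient hΩ (contDiffOn_infty.1 hu 2) hx
    have hp : 0 < 1 + 1 * ‖gradient u x‖ ^ 2 := by positivity
    have hm : 0 < 1 + -1 * ‖gradient u x‖ ^ 2 := by
      nlinarith [hsp x hx, norm_nonneg (gradient u x)]
    have h1 := vdiv_inv_sqrt_smul hd 1 hp
    have h2 := vdiv_inv_sqrt_smul hd (-1) hm
    have e1 := (inv_pos.2 (pow_pos (Real.sqrt_pos.2 hp) 3)).ne'
    have e2 := (inv_pos.2 (pow_pos (Real.sqrt_pos.2 hm) 3)).ne'
    simp only [one_mul, neg_mul, ← sub_eq_add_neg, sub_neg_eq_add] at h1 h2 e1 e2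
    rw [h1, h2, mul_eq_zero_iff_left e1, mul_eq_zero_iff_left e2]
    exact ⟨Iff.rfl, Iff.rfl⟩
  constructor
  · rintro ⟨h1, h2⟩ x hx
    have a := (key x hx).1.1 (h1 x hx)
    have b := (key x hx).2.1 (h2 x hx)
    have hD : vdiv (gradient u) x = 0 := by linarith
    exact ⟨hD, by simpa [hD] using b⟩
  · intro h
    exact ⟨fun x hx => (key x hx).1.2 (by simp [h x hx]),
      fun x hx => (key x hx).2.2 (by simp [h x hx])⟩
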